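/- arXiv:1101.3121 — 6 statements merged into one kernel-verified Lean document; each statement's English description precedes it below -/
import Mathlib

section
/- Jacobi–Anger expansion (plane wave decomposition into circular-cylindrical waves): for every x ∈ ℝ and θ ∈ ℝ, exp(i x cos θ) = ∑_{n ∈ ℤ} iⁿ J_n(x) e^{i n θ}, where the series converges absolutely (and uniformly in θ on ℝ). -/
open Real Complex Filter

noncomputable section

/-- The Bessel function of the first kind of integer order `n`, defined by the integral
representation `J_n(x) = (1/(2π)) ∫_{−π}^{π} exp(i (x sin τ − n τ)) dτ`. -/
def besselJ (n : ℤ) (x : ℝ) : ℂ :=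
  (1 / (2 * Real.pi)) * ∫ τ in (-Real.pi)..Real.pi,
    Complex.exp (Complex.I * ((x : ℂ) * Real.sin τ - (n : ℂ) * (τ : ℂ)))

/-- If `f` takes the same value at both ends of `[a, b]`, its `n`-th Fourier coefficient is that of
its derivative divided by `2πin / (b - a)`. -/
theorem fourierCoeffOn_eq_of_hasDerivAt_of_eq {a b : ℝ} (hab : a < b) {f f' : ℝ → ℂ} {n : ℤ}
    (hn : n ≠ 0) (hf : ∀ x ∈ Set.uIcc a b, HasDerivAt f (f' x) x)
    (hf' : IntervalIntegrable f' MeasureTheory.volume a b) (hfab : f a = f b) :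
    fourierCoeffOn hab f n =
      (b - a) / (2 * Real.pi * Complex.I) * (1 / n) * fourierCoeffOn hab f' n := by
  rw [fourierCoeffOn_of_hasDerivAt hab hn hf hf', hfab]
  have hn' : (n : ℂ) ≠ 0 := by exact_mod_cast hn
  have hpi : (Real.pi : ℂ) ≠ 0 := by exact_mod_cast Real.pi_ne_zero
  field_simp
  ring

theorem norm_fourierCoeffOn_le {a b C : ℝ} (hab : a < b) {f : ℝ → ℂ}
    (hC : ∀ x ∈ Set.uIoc a b, ‖f x‖ ≤ C) (n : ℤ) : ‖fourierCoeffOn hab f n‖ ≤ C := by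
  have hba : 0 < b - a := sub_pos.2 hab
  have : Fact (0 < b - a) := ⟨hba⟩
  rw [fourierCoeffOn_eq_integral, norm_smul, Real.norm_of_nonneg (by positivity)]
  have h : ‖∫ x in a..b, fourier (-n) (x : AddCircle (b - a)) • f x‖ ≤ C * |b - a| := by
    refine intervalIntegral.norm_integral_le_of_norm_le_const fun x hx => ?_
    rw [norm_smul, fourier_apply, Circle.norm_coe, one_mul]
    exact hC x hx
  rw [abs_of_pos hba] at h
  rw [one_div, inv_mul_le_iff₀ hba]
  linarith

/-- The Fourier coefficients of a periodic `C²` function are summable. -/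
theorem summable_fourierCoeffOn_of_hasDerivAt_of_hasDerivAt {a b : ℝ} (hab : a < b)
    {f f' f'' : ℝ → ℂ} (hf : ∀ x ∈ Set.uIcc a b, HasDerivAt f (f' x) x)
    (hf' : ∀ x ∈ Set.uIcc a b, HasDerivAt f' (f'' x) x) (hf'' : ContinuousOn f'' (Set.uIcc a b))
    (hfab : f a = f b) (hfab' : f' a = f' b) : Summable (fourierCoeffOn hab f) := by
  obtain ⟨C, hC⟩ := isCompact_uIcc.exists_bound_of_continuousOn hf''
  have hbound := norm_fourierCoeffOn_le hab fun x hx => hC x (Set.uIoc_subset_uIcc hx)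
  have hcont : ContinuousOn f' (Set.uIcc a b) := fun x hx =>
    (hf' x hx).continuousAt.continuousWithinAt
  refine Summable.of_norm_bounded_eventually
    (g := fun n : ℤ => ‖((b - a) / (2 * Real.pi * Complex.I) : ℂ)‖ ^ 2 * C * (1 / (n : ℝ) ^ 2))
    ((Real.summable_one_div_int_pow.2 one_lt_two).mul_left _) ?_
  filter_upwards [(Set.finite_singleton (0 : ℤ)).compl_mem_cofinite] with n hn
  have hn : n ≠ 0 := hn
  rw [fourierCoeffOn_eq_of_hasDerivAt_of_eq hab hn hf hcont.intervalIntegrable hfab,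
    fourierCoeffOn_eq_of_hasDerivAt_of_eq hab hn hf' hf''.intervalIntegrable hfab']
  calc _ = ‖((b - a) / (2 * Real.pi * Complex.I) : ℂ)‖ ^ 2 * (1 / (n : ℝ) ^ 2)
        * ‖fourierCoeffOn hab f'' n‖ := by
        simp only [norm_mul, norm_div, norm_one, Complex.norm_intCast]
        rw [← sq_abs (n : ℝ)]
        ring
    _ ≤ ‖((b - a) / (2 * Real.pi * Complex.I) : ℂ)‖ ^ 2 * (1 / (n : ℝ) ^ 2) * C := by
        gcongr
        exact hbound n
    _ = _ := by ring

theorem fourierCoeffOn_exp_sin (n : ℤ) (x : ℝ) :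
    fourierCoeffOn (neg_lt_self Real.pi_pos)
      (fun τ : ℝ => Complex.exp (Complex.I * x * Real.sin τ)) n = besselJ n x := by
  rw [fourierCoeffOn_eq_integral, besselJ, Complex.real_smul]
  congr 1
  · push_cast
    ring
  · refine intervalIntegral.integral_congr fun τ _ => ?_
    have hpi : (Real.pi : ℂ) ≠ 0 := by exact_mod_cast Real.pi_ne_zero
    simp only [fourier_coe_apply, smul_eq_mul, ← Complex.exp_add]
    congr 1
    push_cast
    field_simp
    ring

theorem summable_besselJ (x : ℝ) : Summable fun n : ℤ => besselJ n x := by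
  have hs (τ : ℝ) : HasDerivAt (fun τ : ℝ => (Real.sin τ : ℂ)) (Real.cos τ) τ :=
    (Real.hasDerivAt_sin τ).ofReal_comp
  have hc (τ : ℝ) : HasDerivAt (fun τ : ℝ => (Real.cos τ : ℂ)) ((-Real.sin τ : ℝ) : ℂ) τ :=
    (Real.hasDerivAt_cos τ).ofReal_comp
  have he (τ : ℝ) := ((hs τ).const_mul (Complex.I * x)).cexp
  have h := summable_fourierCoeffOn_of_hasDerivAt_of_hasDerivAt (neg_lt_self Real.pi_pos)
    (fun τ _ => he τ) (fun τ _ => (he τ).mul ((hc τ).const_mul (Complex.I * x)))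
    (Continuous.continuousOn (by fun_prop)) (by simp) (by simp)
  simpa only [← fourierCoeffOn_exp_sin] using h

/-- The generating function of the Bessel functions of integer order, on the unit circle. -/
theorem hasSum_besselJ_mul_exp (x τ : ℝ) :
    HasSum (fun n : ℤ => besselJ n x * Complex.exp (Complex.I * n * τ))
      (Complex.exp (Complex.I * x * Real.sin τ)) := by
  have : Fact (0 < 2 * Real.pi) := ⟨Real.two_pi_pos⟩
  have hper : Function.Periodic (fun τ : ℝ => Complex.exp (Complex.I * x * Real.sin τ))
      (2 * Real.pi) := fun τ => by simp only [Real.sin_add_two_pi]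
  let F : C(AddCircle (2 * Real.pi), ℂ) :=
    ⟨hper.lift, continuous_coinduced_dom.mpr (by
      change Continuous fun τ : ℝ => Complex.exp (Complex.I * x * Real.sin τ)
      fun_prop)⟩
  have hF (t : ℝ) : F t = Complex.exp (Complex.I * x * Real.sin t) := hper.lift_coe t
  have hpi : (Real.pi : ℂ) ≠ 0 := by exact_mod_cast Real.pi_ne_zero
  have hcoeff : fourierCoeff F = fun n : ℤ => besselJ n x := by
    ext n
    rw [fourierCoeff_eq_intervalIntegral _ n (-Real.pi), besselJ, Complex.real_smul,
      show -Real.pi + 2 * Real.pi = Real.pi by ring]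
    congr 1
    · push_cast
      ring
    · refine intervalIntegral.integral_congr fun t _ => ?_
      simp only [hF, fourier_coe_apply, smul_eq_mul, ← Complex.exp_add]
      congr 1
      push_cast
      field_simp
      ring
  have h := has_pointwise_sum_fourier_series_of_summable (f := F)
    (hcoeff ▸ summable_besselJ x) (τ : AddCircle (2 * Real.pi))
  rw [hF] at h
  convert h using 2 with n
  rw [hcoeff, fourier_coe_apply, smul_eq_mul]
  congr 2
  push_cast
  field_simp

theorem norm_I_zpow_mul_besselJ_mul_exp (n : ℤ) (x θ : ℝ) :
    ‖Complex.I ^ n * besselJ n x * Complex.exp (Complex.I * (n : ℂ) * (θ : ℂ))‖ =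
      ‖besselJ n x‖ := by
  rw [norm_mul, norm_mul, norm_zpow, Complex.norm_I, one_zpow, one_mul,
    show Complex.I * (n : ℂ) * (θ : ℂ) = ((n * θ : ℝ) : ℂ) * Complex.I by push_cast; ring,
    Complex.norm_exp_ofReal_mul_I, mul_one]

/-- Jacobi–Anger expansion: `exp(i x cos θ) = ∑_{n ∈ ℤ} iⁿ J_n(x) e^{i n θ}`, with absolute
convergence, and uniform convergence in `θ` on `ℝ`. -/
theorem jacobi_anger_expansion (x : ℝ) :
    (∀ θ : ℝ, HasSum
        (fun n : ℤ => Complex.I ^ n * besselJ n x * Complex.exp (Complex.I * (n : ℂ) * (θ : ℂ)))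
        (Complex.exp (Complex.I * (x : ℂ) * Real.cos θ)))
    ∧ (∀ θ : ℝ, Summable
        (fun n : ℤ =>
          ‖Complex.I ^ n * besselJ n x * Complex.exp (Complex.I * (n : ℂ) * (θ : ℂ))‖))
    ∧ TendstoUniformly
        (fun (s : Finset ℤ) (θ : ℝ) =>
          ∑ n ∈ s, Complex.I ^ n * besselJ n x * Complex.exp (Complex.I * (n : ℂ) * (θ : ℂ)))
        (fun θ : ℝ => Complex.exp (Complex.I * (x : ℂ) * Real.cos θ)) atTop := by
  have hsum (θ : ℝ) : HasSum
      (fun n : ℤ => Complex.I ^ n * besselJ n x * Complex.exp (Complex.I * (n : ℂ) * (θ : ℂ)))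
      (Complex.exp (Complex.I * (x : ℂ) * Real.cos θ)) := by
    convert hasSum_besselJ_mul_exp x (θ + Real.pi / 2) using 2 with n
    · have hI : Complex.I ^ n = Complex.exp (Complex.I * n * (Real.pi / 2 : ℝ)) := by
        conv_lhs => rw [← Complex.exp_pi_div_two_mul_I, ← Complex.exp_int_mul]
        congr 1
        push_cast
        ring
      rw [hI, mul_right_comm, ← Complex.exp_add, mul_comm]
      congr 2
      push_cast
      ring
    · rw [Real.sin_add_pi_div_two]
  refine ⟨hsum, fun θ => ?_, ?_⟩
  · simpa only [norm_I_zpow_mul_besselJ_mul_exp] using (summable_besselJ x).norm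
  · simpa only [(hsum _).tsum_eq] using tendstoUniformly_tsum (summable_besselJ x).norm
      fun n θ => (norm_I_zpow_mul_besselJ_mul_exp n x θ).le

end
end

section
/- The Helmholtz–Bessel overlap of a function equals the angular Fourier coefficient of its Fourier transform (Plancherel relation between the plane-wave and circular-cylindrical wave decompositions): let f : ℝ² → ℂ be a Schwartz function and define its Fourier transform F(ξ) = ∫_{ℝ²} f(x) exp(−i⟪ξ, x⟫) dx. Then for every n ∈ ℤ and every k > 0, ∫_{ℝ²} f(x) · \overline{iⁿ J_n(k‖x‖) · ((x₁ + i x₂)/‖x‖)ⁿ} dx = (1/(2π)) ∫_{−π}^{π} F(k cos ψ, k sin ψ) e^{−i n ψ} dψ. -/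
open Real Complex MeasureTheory

noncomputable section

/-- The circular cylindrical wave of order `n` at polar coordinates `(r, φ)`, conjugated, is the
`n`-th Fourier coefficient of the plane waves evaluated at that point. -/
theorem conj_besselJ_mul_exp (n : ℤ) (r φ : ℝ) :
    (starRingEnd ℂ) (I ^ n * besselJ n r * Complex.exp (φ * I) ^ n) =
      (1 / (2 * Real.pi) : ℂ) * ∫ ψ in (-Real.pi)..Real.pi,
        Complex.exp (-I * ((r * Real.cos (ψ - φ) : ℝ) : ℂ)) *
          Complex.exp (-I * (n : ℂ) * (ψ : ℂ)) := by
  set g : ℝ → ℂ := fun ψ => Complex.exp (-I * ((r * Real.cos (ψ - φ) : ℝ) : ℂ)) *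
    Complex.exp (-I * (n : ℂ) * (ψ : ℂ)) with hg
  have hper : Function.Periodic g (2 * Real.pi) := by
    intro ψ
    have hexp : Complex.exp (-I * (n : ℂ) * ((ψ + 2 * Real.pi : ℝ) : ℂ)) =
        Complex.exp (-I * (n : ℂ) * (ψ : ℂ)) := by
      rw [Complex.exp_eq_exp_iff_exists_int]
      exact ⟨-n, by push_cast; ring⟩
    have hcos : Real.cos (ψ + 2 * Real.pi - φ) = Real.cos (ψ - φ) := by
      rw [← Real.cos_add_two_pi (ψ - φ)]
      ring_nf
    simp only [hg, hexp, hcos]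
  have hshift : ∫ τ in (-Real.pi)..Real.pi, g (φ + Real.pi / 2 - τ) =
      ∫ ψ in (-Real.pi)..Real.pi, g ψ := by
    rw [intervalIntegral.integral_comp_sub_left]
    have h := hper.intervalIntegral_add_eq (φ + Real.pi / 2 - Real.pi) (-Real.pi)
    convert h using 2 <;> ring
  have hphase : (starRingEnd ℂ) (I ^ n * Complex.exp (φ * I) ^ n) =
      Complex.exp (-I * n * (φ + Real.pi / 2)) := by
    have hI : I ^ n = Complex.exp (n * (Real.pi / 2 * I)) := by
      rw [Complex.exp_int_mul, Complex.exp_pi_div_two_mul_I]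
    rw [hI, ← Complex.exp_int_mul, ← Complex.exp_add, ← Complex.exp_conj]
    congr 1
    simp only [map_add, map_mul, map_div₀, map_intCast, conj_I, conj_ofReal, map_ofNat]
    ring
  have hJ : (starRingEnd ℂ) (∫ τ in (-Real.pi)..Real.pi,
      Complex.exp (I * ((r : ℂ) * Real.sin τ - (n : ℂ) * (τ : ℂ)))) =
      Complex.exp (I * n * (φ + Real.pi / 2)) * ∫ ψ in (-Real.pi)..Real.pi, g ψ := by
    rw [← hshift, ← intervalIntegral.integral_const_mul,
      intervalIntegral.integral_of_le (by linarith [Real.pi_pos]),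
      intervalIntegral.integral_of_le (by linarith [Real.pi_pos]), ← integral_conj]
    congr 1
    funext τ
    have hcos : Real.cos (φ + Real.pi / 2 - τ - φ) = Real.sin τ := by
      rw [← Real.cos_pi_div_two_sub]
      ring_nf
    simp only [hg, hcos]
    rw [← Complex.exp_conj, ← Complex.exp_add, ← Complex.exp_add]
    congr 1
    simp only [map_sub, map_mul, map_intCast, conj_I, conj_ofReal]
    push_cast
    ring
  have hcancel : Complex.exp (-I * n * (φ + Real.pi / 2)) *
      Complex.exp (I * n * (φ + Real.pi / 2)) = 1 := by
    rw [← Complex.exp_add, ← Complex.exp_zero]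
    congr 1
    ring
  rw [mul_right_comm, map_mul, hphase, besselJ, map_mul, hJ]
  simp only [map_div₀, map_mul, map_one, map_ofNat, conj_ofReal]
  linear_combination ((1 / (2 * Real.pi) : ℂ) * ∫ ψ in (-Real.pi)..Real.pi, g ψ) * hcancel

/-- The conjugated circular cylindrical wave in Cartesian coordinates, away from the origin. -/
theorem conj_besselJ_mul_angular (n : ℤ) (k : ℝ) (x : ℝ × ℝ) (hx : x ≠ 0) :
    (starRingEnd ℂ) (I ^ n * besselJ n (k * Real.sqrt (x.1 ^ 2 + x.2 ^ 2)) *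
        (((x.1 : ℂ) + I * (x.2 : ℂ)) / ((Real.sqrt (x.1 ^ 2 + x.2 ^ 2) : ℝ) : ℂ)) ^ n) =
      (1 / (2 * Real.pi) : ℂ) * ∫ ψ in (-Real.pi)..Real.pi,
        Complex.exp (-I * ((k * Real.cos ψ * x.1 + k * Real.sin ψ * x.2 : ℝ) : ℂ)) *
          Complex.exp (-I * (n : ℂ) * (ψ : ℂ)) := by
  set z : ℂ := ⟨x.1, x.2⟩ with hz
  have hnorm : Real.sqrt (x.1 ^ 2 + x.2 ^ 2) = ‖z‖ := by
    rw [Complex.norm_eq_sqrt_sq_add_sq]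
  have hz0 : z ≠ 0 := fun h =>
    hx (Prod.ext (congrArg Complex.re h) (congrArg Complex.im h))
  have hadd : (x.1 : ℂ) + I * (x.2 : ℂ) = z := by
    rw [mul_comm]
    exact (Complex.mk_eq_add_mul_I x.1 x.2).symm
  have hangle : z / (‖z‖ : ℂ) = Complex.exp (z.arg * I) := by
    have h0 : (‖z‖ : ℂ) ≠ 0 := by simpa using hz0
    rw [div_eq_iff h0, mul_comm]
    exact (Complex.norm_mul_exp_arg_mul_I z).symm
  rw [hnorm, hadd, hangle, conj_besselJ_mul_exp]
  have hdot (ψ : ℝ) : k * ‖z‖ * Real.cos (ψ - z.arg) =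
      k * Real.cos ψ * x.1 + k * Real.sin ψ * x.2 := by
    have hre : ‖z‖ * Real.cos z.arg = x.1 := Complex.norm_mul_cos_arg z
    have him : ‖z‖ * Real.sin z.arg = x.2 := Complex.norm_mul_sin_arg z
    rw [Real.cos_sub, ← hre, ← him]
    ring
  simp only [hdot]

/-- An integrable function times plane waves with directions in the circle is jointly integrable
in direction and position. -/
theorem integrable_mul_planeWave {f : ℝ × ℝ → ℂ} (hf : Integrable f) (n : ℤ) (k : ℝ) (s : Set ℝ)
    [IsFiniteMeasure (volume.restrict s)] :
    Integrable (Function.uncurry fun (ψ : ℝ) (x : ℝ × ℝ) => f x *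
      (Complex.exp (-I * ((k * Real.cos ψ * x.1 + k * Real.sin ψ * x.2 : ℝ) : ℂ)) *
        Complex.exp (-I * (n : ℂ) * (ψ : ℂ)))) ((volume.restrict s).prod volume) := by
  refine (hf.comp_snd (volume.restrict s)).mul_bdd (c := 1)
    (Continuous.aestronglyMeasurable (by fun_prop)) (Filter.Eventually.of_forall fun p => ?_)
  simp [Complex.norm_exp]

/-- Plancherel relation between the plane-wave and circular-cylindrical wave decompositions:
the Helmholtz–Bessel overlap of a Schwartz function equals the angular Fourier coefficient of
its Fourier transform. -/
theorem besselOverlap_eq_angular_fourier_coeff_of_fourierTransform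
    (f : SchwartzMap (ℝ × ℝ) ℂ) (F : ℝ × ℝ → ℂ)
    (hF : ∀ ξ : ℝ × ℝ, F ξ =
      ∫ x : ℝ × ℝ, f x * Complex.exp (-Complex.I * ((ξ.1 * x.1 + ξ.2 * x.2 : ℝ) : ℂ)))
    (n : ℤ) (k : ℝ) (hk : 0 < k) :
    (∫ x : ℝ × ℝ, f x *
        (starRingEnd ℂ) (Complex.I ^ n * besselJ n (k * Real.sqrt (x.1 ^ 2 + x.2 ^ 2)) *
          (((x.1 : ℂ) + Complex.I * (x.2 : ℂ)) /
            ((Real.sqrt (x.1 ^ 2 + x.2 ^ 2) : ℝ) : ℂ)) ^ n))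
      = (1 / (2 * Real.pi) : ℂ) * ∫ ψ in (-Real.pi)..Real.pi,
          F (k * Real.cos ψ, k * Real.sin ψ) * Complex.exp (-Complex.I * (n : ℂ) * (ψ : ℂ)) := by
  have hL : ∀ᵐ x : ℝ × ℝ, f x *
        (starRingEnd ℂ) (Complex.I ^ n * besselJ n (k * Real.sqrt (x.1 ^ 2 + x.2 ^ 2)) *
          (((x.1 : ℂ) + Complex.I * (x.2 : ℂ)) /
            ((Real.sqrt (x.1 ^ 2 + x.2 ^ 2) : ℝ) : ℂ)) ^ n) =
      (1 / (2 * Real.pi) : ℂ) * ∫ ψ in (-Real.pi)..Real.pi, f x *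
        (Complex.exp (-I * ((k * Real.cos ψ * x.1 + k * Real.sin ψ * x.2 : ℝ) : ℂ)) *
          Complex.exp (-I * (n : ℂ) * (ψ : ℂ))) := by
    filter_upwards [Measure.ae_ne volume (0 : ℝ × ℝ)] with x hx
    rw [conj_besselJ_mul_angular n k x hx, intervalIntegral.integral_const_mul]
    ring
  have : IsFiniteMeasure (volume.restrict (Set.uIoc (-Real.pi) Real.pi)) := by
    rw [Set.uIoc]
    infer_instance
  rw [integral_congr_ae hL, integral_const_mul,
    ← intervalIntegral_integral_swap (integrable_mul_planeWave f.integrable n k _)]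
  congr 2
  funext ψ
  rw [hF, ← integral_mul_const]
  simp only [mul_assoc]

end
end

section
/- Parseval identity for the circular-cylindrical (Bessel) wave decomposition: let f : ℝ² → ℂ be a Schwartz function and for n ∈ ℤ, k > 0 define the Bessel overlap b_n(k) = ∫_{ℝ²} f(x) · J_n(k‖x‖) · ((x₁ − i x₂)/‖x‖)ⁿ dx. Then ∫_{ℝ²} |f(x)|² dx = (1/(2π)) ∑_{n ∈ ℤ} ∫_0^∞ |b_n(k)|² k dk. -/
open Real Complex MeasureTheory

noncomputable section

/-- Polar coordinates combined with Parseval's identity on each circle. -/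
theorem integral_norm_sq_eq_tsum_fourierCoeffOn {H : ℂ → ℂ} (hH : Continuous H)
    (hint : Integrable fun z => ‖H z‖ ^ 2) :
    ∫ z, ‖H z‖ ^ 2 = 2 * π * ∑' n : ℤ, ∫ k in Set.Ioi (0 : ℝ),
      ‖fourierCoeffOn (neg_lt_self pi_pos) (fun τ : ℝ => H (k * exp (τ * I))) n‖ ^ 2 * k := by
  have hsub : π - -π = 2 * π := by ring
  set c : ℤ → ℝ → ℂ := fun n k =>
    fourierCoeffOn (neg_lt_self pi_pos) (fun τ : ℝ => H (k * exp (τ * I))) n with hc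
  have hc_cont : ∀ n, Continuous (c n) := by
    intro n
    simp only [hc, fourierCoeffOn_eq_integral, fourier_coe_apply]
    refine Continuous.const_smul
      (intervalIntegral.continuous_parametric_intervalIntegral_of_continuous' ?_ _ _) _
    simp only [Function.uncurry_def]
    fun_prop
  have hsum : ∀ k : ℝ, HasSum (fun n => ‖c n k‖ ^ 2)
      ((2 * π)⁻¹ * ∫ τ in -π..π, ‖H (k * exp (τ * I))‖ ^ 2) := by
    intro k
    have hcont : Continuous fun τ : ℝ => H (k * exp (τ * I)) := by fun_prop
    have hL2 : MemLp (fun τ : ℝ => H (k * exp (τ * I))) 2 (volume.restrict (Set.Ioc (-π) π)) :=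
      (memLp_two_iff_integrable_sq_norm hcont.aestronglyMeasurable).2
        (hcont.norm.pow 2).integrableOn_Ioc
    simpa [hsub, smul_eq_mul] using hasSum_sq_fourierCoeffOn (neg_lt_self pi_pos) hL2
  set G : ℝ → ℝ := fun k => ∫ τ in -π..π, ‖H (k * exp (τ * I))‖ ^ 2 with hG
  have hpolar : ∀ p : ℝ × ℝ, Complex.polarCoord.symm p = p.1 * exp (p.2 * I) := by
    intro p
    rw [Complex.polarCoord_symm_apply, exp_mul_I, ofReal_cos, ofReal_sin]
  have hint' : IntegrableOn (fun p : ℝ × ℝ => p.1 * ‖H (p.1 * exp (p.2 * I))‖ ^ 2)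
      (Set.Ioi (0 : ℝ) ×ˢ Set.Ioo (-π) π) := by
    refine ⟨by fun_prop, ?_⟩
    have h1 := Complex.lintegral_comp_polarCoord_symm (fun z => ENNReal.ofReal (‖H z‖ ^ 2))
    have h2 := hint.2
    rw [hasFiniteIntegral_iff_ofReal (ae_of_all _ fun z => by positivity), ← h1] at h2
    rw [hasFiniteIntegral_iff_ofReal]
    · refine lt_of_le_of_lt (le_of_eq ?_) h2
      refine setLIntegral_congr_fun (measurableSet_Ioi.prod measurableSet_Ioo) fun p hp => ?_
      simp only [hpolar, smul_eq_mul]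
      rw [ENNReal.ofReal_mul (Set.mem_Ioi.1 hp.1).le]
    · refine (ae_restrict_iff' (measurableSet_Ioi.prod measurableSet_Ioo)).2
        (ae_of_all _ fun p hp => ?_)
      have := (Set.mem_Ioi.1 hp.1).le
      simp only [Pi.zero_apply]
      positivity
  have hprod : ((volume : Measure (ℝ × ℝ)).restrict (Set.Ioi (0 : ℝ) ×ˢ Set.Ioo (-π) π)) =
      (volume.restrict (Set.Ioi (0 : ℝ))).prod (volume.restrict (Set.Ioo (-π) π)) := by
    rw [Measure.volume_eq_prod, Measure.prod_restrict]
  have hGk : ∀ k : ℝ, ∫ τ in Set.Ioo (-π) π, k * ‖H (k * exp (τ * I))‖ ^ 2 = k * G k := by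
    intro k
    rw [integral_const_mul, hG]
    simp only
    rw [intervalIntegral.integral_of_le (neg_lt_self pi_pos).le, integral_Ioc_eq_integral_Ioo]
  have hGint : IntegrableOn (fun k => k * G k) (Set.Ioi 0) := by
    rw [IntegrableOn, hprod] at hint'
    simpa only [hGk, IntegrableOn] using hint'.integral_prod_left
  have hmain : ∫ z, ‖H z‖ ^ 2 = ∫ k in Set.Ioi (0 : ℝ), k * G k := by
    rw [← Complex.integral_comp_polarCoord_symm]
    simp only [hpolar, smul_eq_mul, polarCoord, ← hGk]
    rw [IntegrableOn, hprod] at hint'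
    rw [hprod, integral_prod _ hint']
  have hterm : ∀ k : ℝ, HasSum (fun n => ‖c n k‖ ^ 2 * k) ((2 * π)⁻¹ * (k * G k)) := by
    intro k
    have := (hsum k).mul_right k
    rwa [mul_assoc, mul_comm (∫ _ in _.._, _)] at this
  have hfin : ∑' n, ∫⁻ k in Set.Ioi (0 : ℝ), ‖‖c n k‖ ^ 2 * k‖ₑ ≠ ⊤ := by
    rw [← lintegral_tsum fun n => by have := hc_cont n; fun_prop]
    refine ne_of_lt (lt_of_le_of_lt (le_of_eq ?_) (hGint.const_mul (2 * π)⁻¹).2)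
    refine setLIntegral_congr_fun measurableSet_Ioi fun k hk => ?_
    have hk' : 0 ≤ k := (Set.mem_Ioi.1 hk).le
    have hnn : ∀ n, 0 ≤ ‖c n k‖ ^ 2 * k := fun n => by positivity
    simp only
    rw [← (hterm k).tsum_eq, Real.enorm_of_nonneg (tsum_nonneg hnn),
      ENNReal.ofReal_tsum_of_nonneg hnn (hterm k).summable]
    exact tsum_congr fun n => Real.enorm_of_nonneg (hnn n)
  rw [hmain, ← integral_tsum (fun n => by have := hc_cont n; fun_prop) hfin]
  simp only [(hterm _).tsum_eq]
  rw [integral_const_mul]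
  field_simp

open ComplexConjugate FourierTransform SchwartzMap

theorem integral_exp_im_mul_exp_eq_besselJ (n : ℤ) (k : ℝ) {v : ℂ} (hv : v ≠ 0) :
    (1 / (2 * π)) * ∫ τ in (-π)..π,
        exp (-(n * τ * I)) * exp (I * ((conj v * (k * exp (τ * I))).im : ℝ)) =
      besselJ n (k * ‖v‖) * (conj v / ‖v‖) ^ n := by
  set θ := arg v with hθ
  have hv' : (‖v‖ : ℂ) ≠ 0 := by simpa using hv
  have hconj : conj v = ‖v‖ * exp (-θ * I) := by
    conv_lhs => rw [← norm_mul_exp_arg_mul_I v]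
    rw [map_mul, conj_ofReal, ← exp_conj, map_mul, conj_ofReal, conj_I, mul_neg, neg_mul]
  set φ : ℝ → ℂ := fun τ => exp (I * (((k * ‖v‖ : ℝ) : ℂ) * Real.sin τ - n * τ)) with hφ
  have hper : Function.Periodic φ (2 * π) := by
    intro τ
    simp only [hφ, Real.sin_add_two_pi]
    rw [exp_eq_exp_iff_exists_int]
    refine ⟨-n, ?_⟩
    push_cast
    ring
  have hint : ∀ τ : ℝ, exp (-(n * τ * I)) * exp (I * ((conj v * (k * exp (τ * I))).im : ℝ)) =
      φ (τ - θ) * exp (-θ * I) ^ n := by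
    intro τ
    have him : (conj v * (k * exp (τ * I))).im = k * ‖v‖ * Real.sin (τ - θ) := by
      have : conj v * (k * exp (τ * I)) = ((k * ‖v‖ : ℝ) : ℂ) * exp ((τ - θ : ℝ) * I) := by
        rw [hconj]
        push_cast
        rw [show ((τ : ℂ) - θ) * I = -θ * I + τ * I by ring, Complex.exp_add]
        ring
      rw [this, im_ofReal_mul, exp_ofReal_mul_I_im]
    rw [him, ← exp_int_mul, ← Complex.exp_add, hφ, ← Complex.exp_add]
    congr 1
    push_cast
    ring
  have hshift : ∫ τ in (-π)..π, φ (τ - θ) = ∫ τ in (-π)..π, φ τ := by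
    rw [intervalIntegral.integral_comp_sub_right]
    have := hper.intervalIntegral_add_eq (-π - θ) (-π)
    rwa [show -π - θ + 2 * π = π - θ by ring, show -π + 2 * π = π by ring] at this
  simp only [hint]
  rw [intervalIntegral.integral_mul_const, hshift, besselJ, hconj, mul_div_cancel_left₀ _ hv',
    mul_assoc]

/-- The Fourier transform of `g`, normalised to the kernel `exp (i Im (v̄ w))`. -/
def symplecticFourier (g : 𝓢(ℂ, ℂ)) (w : ℂ) : ℂ :=
  𝓕 g ((2 * π)⁻¹ • (I * w))

theorem symplecticFourier_eq_integral (g : 𝓢(ℂ, ℂ)) (w : ℂ) :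
    symplecticFourier g w = ∫ v, exp (I * ((conj v * w).im : ℝ)) * g v := by
  rw [symplecticFourier, fourier_coe, Real.fourier_eq']
  refine integral_congr_ae (ae_of_all _ fun v => ?_)
  simp only [smul_eq_mul]
  congr 2
  have : inner ℝ v ((2 * π)⁻¹ • (I * w)) = (2 * π)⁻¹ * -(conj v * w).im := by
    rw [real_inner_smul_right, Complex.inner]
    congr 1
    simp
    ring
  rw [this]
  push_cast
  field_simp

theorem continuous_symplecticFourier (g : 𝓢(ℂ, ℂ)) : Continuous (symplecticFourier g) := by
  unfold symplecticFourier
  fun_prop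

theorem symplecticFourier_eq_comp_rotation (g : 𝓢(ℂ, ℂ)) (w : ℂ) :
    symplecticFourier g w = 𝓕 g ((2 * π)⁻¹ • rotation (Circle.exp (π / 2)) w) := by
  rw [symplecticFourier, rotation_apply, Circle.coe_exp]
  push_cast
  rw [Complex.exp_pi_div_two_mul_I]

theorem integrable_norm_sq_fourier (g : 𝓢(ℂ, ℂ)) : Integrable fun z => ‖𝓕 g z‖ ^ 2 :=
  ((𝓕 g).memLp 2).integrable_norm_pow (by norm_num)

theorem integrable_norm_sq_symplecticFourier (g : 𝓢(ℂ, ℂ)) :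
    Integrable fun w => ‖symplecticFourier g w‖ ^ 2 := by
  simp only [symplecticFourier_eq_comp_rotation]
  exact (rotation _).measurePreserving.integrable_comp_of_integrable
    ((integrable_norm_sq_fourier g).comp_smul (by positivity))

theorem integral_norm_sq_symplecticFourier (g : 𝓢(ℂ, ℂ)) :
    ∫ w, ‖symplecticFourier g w‖ ^ 2 = (2 * π) ^ 2 * ∫ v, ‖g v‖ ^ 2 := by
  simp only [symplecticFourier_eq_comp_rotation]
  rw [(rotation _).measurePreserving.integral_comp
    (rotation _).toHomeomorph.measurableEmbedding (fun z => ‖𝓕 g ((2 * π)⁻¹ • z)‖ ^ 2),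
    Measure.integral_comp_smul volume (fun z => ‖𝓕 g z‖ ^ 2), integral_norm_sq_fourier,
    Complex.finrank_real_complex, smul_eq_mul, abs_of_pos (by positivity), inv_pow, inv_inv]

theorem fourierCoeffOn_symplecticFourier (g : 𝓢(ℂ, ℂ)) (n : ℤ) (k : ℝ) :
    fourierCoeffOn (neg_lt_self pi_pos)
        (fun τ : ℝ => symplecticFourier g (k * exp (τ * I))) n =
      ∫ v, g v * besselJ n (k * ‖v‖) * (conj v / ‖v‖) ^ n := by
  have hker : ∀ τ : ℝ, fourier (-n) (τ : AddCircle (π - -π)) = exp (-(n * τ * I)) := by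
    intro τ
    rw [fourier_coe_apply]
    congr 1
    push_cast
    field_simp
    ring
  set F : ℝ → ℂ → ℂ := fun τ v =>
    exp (-(n * τ * I)) * (exp (I * ((conj v * (k * exp (τ * I))).im : ℝ)) * g v) with hF
  have hFint : Integrable (Function.uncurry F)
      ((volume.restrict (Set.uIoc (-π) π)).prod volume) := by
    have hg : Integrable (fun p : ℝ × ℂ => g p.2)
        ((volume.restrict (Set.uIoc (-π) π)).prod volume) := by
      have : IsFiniteMeasure (volume.restrict (Set.uIoc (-π) π)) := by
        rw [Set.uIoc]
        infer_instance
      simpa using (integrable_const (1 : ℂ)).mul_prod (μ := volume.restrict (Set.uIoc (-π) π))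
        g.integrable
    refine hg.mono (Continuous.aestronglyMeasurable ?_) (ae_of_all _ fun p => ?_)
    · simp only [hF, Function.uncurry_def]
      fun_prop
    · simp only [hF, Function.uncurry_def, norm_mul]
      rw [mul_comm I, norm_exp_ofReal_mul_I, one_mul,
        show -((n : ℂ) * p.1 * I) = ((-(n * p.1) : ℝ) : ℂ) * I by push_cast; ring,
        norm_exp_ofReal_mul_I, one_mul]
  rw [fourierCoeffOn_eq_integral]
  simp only [hker, symplecticFourier_eq_integral, smul_eq_mul, ← integral_const_mul]
  rw [intervalIntegral_integral_swap hFint, ← integral_smul]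
  refine integral_congr_ae ?_
  filter_upwards [Measure.ae_ne volume (0 : ℂ)] with v hv
  rw [mul_assoc (g v), ← integral_exp_im_mul_exp_eq_besselJ n k hv]
  simp only [hF, ← mul_assoc, intervalIntegral.integral_mul_const]
  rw [real_smul, show π - -π = 2 * π by ring]
  push_cast
  ring

/-- Parseval identity for the circular-cylindrical (Bessel) wave decomposition:
`∫ |f|² = (1/(2π)) ∑_{n ∈ ℤ} ∫₀^∞ |b_n(k)|² k dk`. -/
theorem parseval_bessel_wave_decomposition (f : SchwartzMap (ℝ × ℝ) ℂ) (b : ℤ → ℝ → ℂ)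
    (hb : ∀ (n : ℤ) (k : ℝ), 0 < k → b n k =
      ∫ x : ℝ × ℝ, f x * besselJ n (k * Real.sqrt (x.1 ^ 2 + x.2 ^ 2)) *
        (((x.1 : ℂ) - Complex.I * (x.2 : ℂ)) /
          ((Real.sqrt (x.1 ^ 2 + x.2 ^ 2) : ℝ) : ℂ)) ^ n) :
    (∫ x : ℝ × ℝ, ‖f x‖ ^ 2)
      = (1 / (2 * Real.pi)) * ∑' n : ℤ, ∫ k in Set.Ioi (0 : ℝ), ‖b n k‖ ^ 2 * k := by
  set g : 𝓢(ℂ, ℂ) := SchwartzMap.compCLMOfContinuousLinearEquiv ℂ equivRealProdCLM f with hg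
  have hcomp : ∀ {E : Type} [NormedAddCommGroup E] [NormedSpace ℝ E] (F : ℝ × ℝ → E),
      ∫ x, F x = ∫ v : ℂ, F (v.re, v.im) := fun F =>
    (volume_preserving_equiv_real_prod.integral_comp
      measurableEquivRealProd.measurableEmbedding F).symm
  have hgf : ∀ v : ℂ, f (v.re, v.im) = g v := fun v => rfl
  have hbc : ∀ (n : ℤ) (k : ℝ), 0 < k → b n k = fourierCoeffOn (neg_lt_self pi_pos)
      (fun τ : ℝ => symplecticFourier g (k * exp (τ * I))) n := by
    intro n k hk
    rw [hb n k hk, hcomp, fourierCoeffOn_symplecticFourier]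
    refine integral_congr_ae (ae_of_all _ fun v => ?_)
    have hnorm : √(v.re ^ 2 + v.im ^ 2) = ‖v‖ := by rw [norm_eq_sqrt_sq_add_sq]
    have hconj : (v.re : ℂ) - I * v.im = conj v := by
      apply Complex.ext <;> simp
    simp only [hgf, hnorm, hconj]
  have hsum : ∑' n : ℤ, ∫ k in Set.Ioi (0 : ℝ), ‖b n k‖ ^ 2 * k =
      ∑' n : ℤ, ∫ k in Set.Ioi (0 : ℝ), ‖fourierCoeffOn (neg_lt_self pi_pos)
        (fun τ : ℝ => symplecticFourier g (k * exp (τ * I))) n‖ ^ 2 * k :=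
    tsum_congr fun n => setIntegral_congr_fun measurableSet_Ioi fun k hk => by
      simp only [hbc n k hk]
  have hpars := integral_norm_sq_eq_tsum_fourierCoeffOn (continuous_symplecticFourier g)
    (integrable_norm_sq_symplecticFourier g)
  rw [integral_norm_sq_symplecticFourier, ← hsum] at hpars
  rw [hcomp]
  simp only [hgf]
  field_simp
  have hpi : 2 * π ≠ 0 := by positivity
  refine mul_left_cancel₀ hpi ?_
  linear_combination hpars

end
end

section
/- The mean value of the orbital angular momentum is computed from the Bessel-wave (equivalently, via Plancherel, Fourier) coefficients: let f : ℝ² → ℂ be a Schwartz function and for n ∈ ℤ, k > 0 define the Bessel overlap b_n(k) = ∫_{ℝ²} f(x) · J_n(k‖x‖) · ((x₁ − i x₂)/‖x‖)ⁿ dx. Then ∫_{ℝ²} \overline{f(x)} · (l_z f)(x) dx = (1/(2π)) ∑_{n ∈ ℤ} n ∫_0^∞ |b_n(k)|² k dk. -/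
open Real Complex MeasureTheory

noncomputable section

/-- The orbital angular momentum operator on functions on ℝ²:
`(l_z f)(x) = −i (x₁ ∂f/∂x₂ (x) − x₂ ∂f/∂x₁ (x))`. -/
def lz (f : ℝ × ℝ → ℂ) (x : ℝ × ℝ) : ℂ :=
  -Complex.I * ((x.1 : ℂ) * fderiv ℝ f x (0, 1) - (x.2 : ℂ) * fderiv ℝ f x (1, 0))

theorem polarCoord_symm_eq_circleMap (r t : ℝ) :
    Complex.polarCoord.symm (r, t) = circleMap 0 r t := by
  simp [circleMap, Complex.exp_mul_I]

theorem integrableOn_polarCoord_symm {h : ℂ → ℂ} (hh : Integrable h) :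
    IntegrableOn (fun p : ℝ × ℝ => p.1 • h (circleMap 0 p.1 p.2))
      (Set.Ioi (0 : ℝ) ×ˢ Set.Ioo (-π) π) := by
  have h1 : Integrable (fun p : ℝ × ℝ => h (Complex.measurableEquivRealProd.symm p)) :=
    (Complex.volume_preserving_equiv_real_prod.symm).integrable_comp_of_integrable hh
  have h2 := (integrableOn_image_iff_integrableOn_abs_det_fderiv_smul volume
    (polarCoord.open_target.measurableSet)
    (fun p _ ↦ (hasFDerivAt_polarCoord_symm p).hasFDerivWithinAt) polarCoord.symm.injOn
    (fun p : ℝ × ℝ => h (Complex.measurableEquivRealProd.symm p))).1 h1.integrableOn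
  simp_rw [det_fderivPolarCoordSymm, Complex.measurableEquivRealProd_symm_polarCoord_symm_apply]
    at h2
  refine h2.congr_fun (fun p hp => ?_) polarCoord.open_target.measurableSet
  have hp' : 0 < p.1 := hp.1
  simp only [abs_of_pos hp', ← polarCoord_symm_eq_circleMap]

theorem integral_polar {h : ℂ → ℂ} (hh : Integrable h) :
    ∫ z, h z = ∫ r in Set.Ioi (0 : ℝ), (r : ℂ) * ∫ t in (-π)..π, h (circleMap 0 r t) := by
  have h1 := integrableOn_polarCoord_symm hh
  rw [← Complex.integral_comp_polarCoord_symm, polarCoord_target, Measure.volume_eq_prod]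
  rw [IntegrableOn, Measure.volume_eq_prod] at h1
  simp_rw [← polarCoord_symm_eq_circleMap] at h1 ⊢
  rw [setIntegral_prod _ h1]
  refine setIntegral_congr_fun measurableSet_Ioi fun r _ => ?_
  simp only [Complex.real_smul,
    intervalIntegral.integral_of_le (neg_le_self pi_pos.le), integral_Ioc_eq_integral_Ioo,
    integral_const_mul]

theorem integrableOn_circle_integral {h : ℂ → ℂ} (hh : Integrable h) :
    IntegrableOn (fun r : ℝ => (r : ℂ) * ∫ t in (-π)..π, h (circleMap 0 r t)) (Set.Ioi 0) := by
  have h1 := integrableOn_polarCoord_symm hh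
  rw [IntegrableOn, Measure.volume_eq_prod, ← Measure.prod_restrict] at h1
  refine h1.integral_prod_left.congr (Filter.Eventually.of_forall fun r => ?_)
  simp only [Complex.real_smul,
    intervalIntegral.integral_of_le (neg_le_self pi_pos.le), integral_Ioc_eq_integral_Ioo,
    integral_const_mul]

/-- Polarised Parseval identity for Fourier coefficients on an interval. -/
theorem hasSum_conj_fourierCoeffOn_mul {a b : ℝ} {f g : ℝ → ℂ} (hab : a < b)
    (hf : MemLp f 2 (volume.restrict (Set.Ioc a b)))
    (hg : MemLp g 2 (volume.restrict (Set.Ioc a b))) :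
    HasSum (fun n => (starRingEnd ℂ) (fourierCoeffOn hab f n) * fourierCoeffOn hab g n)
      ((b - a)⁻¹ • ∫ x in a..b, (starRingEnd ℂ) (f x) * g x) := by
  have := Fact.mk (by linarith : 0 < b - a)
  rw [← add_sub_cancel a b] at hf hg
  have hf' := hf.memLp_liftIoc.haarAddCircle
  have hg' := hg.memLp_liftIoc.haarAddCircle
  convert! (fourierBasis (T := b - a)).hasSum_inner_mul_inner hf'.toLp hg'.toLp using 1
  · ext n
    rw [← inner_conj_symm, ← HilbertBasis.repr_apply_apply, ← HilbertBasis.repr_apply_apply,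
      fourierBasis_repr, fourierBasis_repr, fourierCoeff_congr_ae hf'.coeFn_toLp,
      fourierCoeff_congr_ae hg'.coeFn_toLp]
    simp [fourierCoeff_liftIoc_eq]
  · rw [L2.inner_def]
    nth_rw 2 [← add_sub_cancel a b]
    rw [← AddCircle.integral_liftIoc_eq_intervalIntegral, ← AddCircle.integral_haarAddCircle]
    apply integral_congr_ae
    filter_upwards [hf'.coeFn_toLp, hg'.coeFn_toLp] with x hx hy
    rw [hx, hy, RCLike.inner_apply']
    rfl

/-- The `n`-th angular Fourier coefficient of `h` on the circle of radius `r`. -/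
def angularCoeff (h : ℂ → ℂ) (n : ℤ) (r : ℝ) : ℂ :=
  fourierCoeffOn (neg_lt_self pi_pos) (fun t => h (circleMap 0 r t)) n

theorem angularCoeff_eq_integral (h : ℂ → ℂ) (n : ℤ) (r : ℝ) :
    angularCoeff h n r =
      (1 / (2 * π)) * ∫ t in (-π)..π, cexp (-(n * t * I)) * h (circleMap 0 r t) := by
  rw [angularCoeff, fourierCoeffOn_eq_integral, Complex.real_smul]
  congr 1
  · push_cast; ring
  · refine intervalIntegral.integral_congr fun t _ => ?_
    simp only [fourier_coe_apply, smul_eq_mul]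
    congr 2
    have : (π : ℂ) ≠ 0 := by exact_mod_cast pi_ne_zero
    push_cast
    field_simp
    ring

theorem continuous_angularCoeff {h : ℂ → ℂ} (hh : Continuous h) (n : ℤ) :
    Continuous (angularCoeff h n) := by
  rw [funext (angularCoeff_eq_integral h n)]
  refine continuous_const.mul ?_
  refine intervalIntegral.continuous_parametric_intervalIntegral_of_continuous' ?_ _ _
  unfold Function.uncurry circleMap
  fun_prop

/-- The orbital angular momentum operator in the complex coordinate `z = x₁ + i x₂`. -/
def lzComplex (h : ℂ → ℂ) (z : ℂ) : ℂ :=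
  -I * (z.re * fderiv ℝ h z I - z.im * fderiv ℝ h z 1)

theorem hasDerivAt_comp_circleMap {h : ℂ → ℂ} (hh : Differentiable ℝ h) (r t : ℝ) :
    HasDerivAt (fun t => h (circleMap 0 r t)) (I * lzComplex h (circleMap 0 r t)) t := by
  have := (hh (circleMap 0 r t)).hasFDerivAt.comp_hasDerivAt t (hasDerivAt_circleMap 0 r t)
  convert! this using 1
  set z := circleMap 0 r t
  have hz : z * I = z.re • I - z.im • (1 : ℂ) := by
    apply Complex.ext <;> simp
  rw [hz, map_sub, map_smul, map_smul, lzComplex, Complex.real_smul, Complex.real_smul]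
  linear_combination (-(z.re * fderiv ℝ h z I - z.im * fderiv ℝ h z 1)) * I_mul_I

theorem angularCoeff_lzComplex {h : ℂ → ℂ} (hh : ContDiff ℝ 1 h) (n : ℤ) (r : ℝ) :
    angularCoeff (lzComplex h) n r = n * angularCoeff h n r := by
  have hc : Continuous (fun t : ℝ => lzComplex h (circleMap 0 r t)) := by
    have : Continuous (fderiv ℝ h) := hh.continuous_fderiv one_ne_zero
    unfold lzComplex
    fun_prop
  rw [angularCoeff_eq_integral, angularCoeff_eq_integral]
  have hE : ∀ t : ℝ, HasDerivAt (fun t : ℝ => cexp (-(n * t * I)))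
      (cexp (-(n * t * I)) * (-(n * I))) t := by
    intro t
    refine HasDerivAt.cexp ?_
    simpa using (((Complex.ofRealCLM.hasDerivAt (x := t)).const_mul (n : ℂ)).mul_const I).fun_neg
  have key := intervalIntegral.integral_mul_deriv_eq_deriv_mul (a := -π) (b := π)
    (fun t _ => hE t)
    (fun t _ => hasDerivAt_comp_circleMap (hh.differentiable one_ne_zero) r t)
    (by apply Continuous.intervalIntegrable; fun_prop)
    (by apply Continuous.intervalIntegrable; fun_prop)
  have e1 : circleMap 0 r (-π) = circleMap 0 r π := by
    have := periodic_circleMap 0 r (-π)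
    rw [← this]; congr 1; ring
  have e2 : cexp (-(n * (-π : ℝ) * I)) = cexp (-(n * π * I)) := by
    rw [Complex.exp_eq_exp_iff_exists_int]
    exact ⟨n, by push_cast; ring⟩
  rw [e1, e2, sub_self, zero_sub] at key
  have l1 : (fun t : ℝ => cexp (-(n * t * I)) * (I * lzComplex h (circleMap 0 r t))) =
      fun t : ℝ => I * (cexp (-(n * t * I)) * lzComplex h (circleMap 0 r t)) := by
    ext t; ring
  have l2 : (fun t : ℝ => cexp (-(n * t * I)) * (-(n * I)) * h (circleMap 0 r t)) =
      fun t : ℝ => (-(n * I)) * (cexp (-(n * t * I)) * h (circleMap 0 r t)) := by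
    ext t; ring
  rw [l1, l2, intervalIntegral.integral_const_mul, intervalIntegral.integral_const_mul] at key
  have key' := mul_left_cancel₀ I_ne_zero (key.trans (by ring :
    _ = I * (n * ∫ t in (-π)..π, cexp (-(n * t * I)) * h (circleMap 0 r t))))
  rw [key']
  ring

theorem memLp_two_of_continuous {f : ℝ → ℂ} (hf : Continuous f) (a b : ℝ) :
    MemLp f 2 (volume.restrict (Set.Ioc a b)) := by
  rw [memLp_two_iff_integrable_sq_norm hf.aestronglyMeasurable]
  exact (hf.norm.pow 2).integrableOn_Ioc

theorem hasSum_conj_angularCoeff_mul {h g : ℂ → ℂ} (hh : Continuous h) (hg : Continuous g)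
    (r : ℝ) :
    HasSum (fun n => (starRingEnd ℂ) (angularCoeff h n r) * angularCoeff g n r)
      ((1 / (2 * π) : ℂ) *
        ∫ t in (-π)..π, (starRingEnd ℂ) (h (circleMap 0 r t)) * g (circleMap 0 r t)) := by
  have := hasSum_conj_fourierCoeffOn_mul (neg_lt_self pi_pos)
    (memLp_two_of_continuous (hh.comp (continuous_circleMap 0 r)) (-π) π)
    (memLp_two_of_continuous (hg.comp (continuous_circleMap 0 r)) (-π) π)
  convert! this using 1
  rw [Complex.real_smul]
  congr 1
  push_cast
  ring

theorem hasSum_normSq_angularCoeff {h : ℂ → ℂ} (hh : Continuous h) (r : ℝ) :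
    HasSum (fun n => ‖angularCoeff h n r‖ ^ 2)
      (((1 / (2 * π) : ℂ) * ∫ t in (-π)..π,
        (starRingEnd ℂ) (h (circleMap 0 r t)) * h (circleMap 0 r t)).re) := by
  have := Complex.hasSum_re (hasSum_conj_angularCoeff_mul hh hh r)
  convert! this using 1
  ext n
  rw [Complex.conj_mul', ← Complex.ofReal_pow, Complex.ofReal_re]

/-- Parseval's identity in polar coordinates. -/
theorem hasSum_integral_conj_angularCoeff_mul {h g : ℂ → ℂ} (hh : Continuous h)
    (hg : Continuous g) (ihh : Integrable fun z => (starRingEnd ℂ) (h z) * h z)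
    (igg : Integrable fun z => (starRingEnd ℂ) (g z) * g z)
    (ihg : Integrable fun z => (starRingEnd ℂ) (h z) * g z) :
    HasSum (fun n => ∫ r in Set.Ioi (0 : ℝ),
        (starRingEnd ℂ) (angularCoeff h n r) * angularCoeff g n r * r)
      ((1 / (2 * π) : ℂ) * ∫ z, (starRingEnd ℂ) (h z) * g z) := by
  have bound_hasSum (r : ℝ) : HasSum
      (fun n => (‖angularCoeff h n r‖ ^ 2 + ‖angularCoeff g n r‖ ^ 2) * |r|) _ :=
    ((hasSum_normSq_angularCoeff hh r).add (hasSum_normSq_angularCoeff hg r)).mul_right |r|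
  rw [integral_polar ihg, ← integral_const_mul]
  refine hasSum_integral_of_dominated_convergence
    (fun n r => (‖angularCoeff h n r‖ ^ 2 + ‖angularCoeff g n r‖ ^ 2) * |r|)
    (fun n => ?_) (fun n => ?_) ?_ ?_ ?_
  · have := continuous_angularCoeff hh n
    have := continuous_angularCoeff hg n
    exact Continuous.aestronglyMeasurable (by fun_prop)
  · refine Filter.Eventually.of_forall fun r => ?_
    rw [norm_mul, norm_mul, RCLike.norm_conj, Complex.norm_real, Real.norm_eq_abs]
    gcongr
    nlinarith [sq_nonneg (‖angularCoeff h n r‖ - ‖angularCoeff g n r‖),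
      sq_nonneg ‖angularCoeff h n r‖, sq_nonneg ‖angularCoeff g n r‖]
  · exact Filter.Eventually.of_forall fun r => (bound_hasSum r).summable
  · simp_rw [fun r => (bound_hasSum r).tsum_eq]
    have := (((integrableOn_circle_integral ihh).add
      (integrableOn_circle_integral igg)).const_mul (1 / (2 * π) : ℂ)).re
    refine Integrable.congr this ?_
    filter_upwards [self_mem_ae_restrict measurableSet_Ioi] with r hr
    have hr : 0 < r := hr
    rw [abs_of_pos hr, ← Complex.add_re, ← Complex.re_mul_ofReal]
    simp only [Pi.add_apply, RCLike.re_eq_complex_re]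
    congr 1
    ring
  · refine Filter.Eventually.of_forall fun r => ?_
    convert! (hasSum_conj_angularCoeff_mul hh hg r).mul_right (r : ℂ) using 1
    ring

theorem integral_bessel_kernel (n : ℤ) (k : ℝ) {x : ℂ} (hx : x ≠ 0) :
    ∫ t in (-π)..π, cexp (-(n * t * I)) * cexp (-(k * (‖x‖ * Real.cos (t - arg x)) : ℝ) * I) =
      2 * π * (-I) ^ n * (besselJ n (k * ‖x‖) * ((starRingEnd ℂ) x / ‖x‖) ^ n) := by
  have hx' : (‖x‖ : ℂ) ≠ 0 := by simpa using hx
  have hconj : (starRingEnd ℂ) x / ‖x‖ = cexp (-(arg x * I)) := by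
    rw [div_eq_iff hx']
    conv_lhs => rw [← norm_mul_exp_arg_mul_I x]
    rw [map_mul, ← Complex.exp_conj, map_mul, Complex.conj_ofReal, Complex.conj_ofReal, conj_I]
    rw [mul_comm]; congr 2; ring
  have hI : -I = cexp (-(π / 2 * I)) := by
    rw [Complex.exp_neg, Complex.exp_pi_div_two_mul_I, Complex.inv_I]
  let φ : ℝ := arg x + π / 2
  let F : ℝ → ℂ := fun t =>
    cexp (-(n * t * I)) * cexp (-(k * (‖x‖ * Real.cos (t - arg x)) : ℝ) * I)
  have hper : Function.Periodic F (2 * π) := by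
    intro t
    simp only [F]
    congr 1
    · rw [Complex.exp_eq_exp_iff_exists_int]
      exact ⟨-n, by push_cast; ring⟩
    · rw [show t + 2 * π - arg x = t - arg x + 2 * π by ring, Real.cos_add_two_pi]
  have hshift : ∫ t in (-π)..π, F t = ∫ t in (-π)..π, F (t + φ) := by
    rw [intervalIntegral.integral_comp_add_right]
    have := hper.intervalIntegral_add_eq (-π) (-π + φ)
    convert! this using 2 <;> ring
  rw [hshift, besselJ, hconj, hI, ← Complex.exp_int_mul, ← Complex.exp_int_mul]
  have : ∀ t : ℝ, F (t + φ) = (cexp (n * -(π / 2 * I)) * cexp (n * -(arg x * I))) *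
      cexp (I * (((k * ‖x‖ : ℝ) : ℂ) * Real.sin t - (n : ℂ) * (t : ℂ))) := by
    intro t
    simp only [F, φ]
    rw [show t + (arg x + π / 2) - arg x = t + π / 2 by ring, Real.cos_add_pi_div_two,
      ← Complex.exp_add, ← Complex.exp_add, ← Complex.exp_add]
    congr 1
    push_cast
    ring
  simp_rw [this]
  rw [intervalIntegral.integral_const_mul]
  field_simp

theorem inner_circleMap (x : ℂ) (r t : ℝ) :
    inner ℝ x (circleMap 0 r t) = r * (‖x‖ * Real.cos (t - arg x)) := by
  rw [Complex.inner, Real.cos_sub]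
  have h1 := Complex.norm_mul_cos_arg x
  have h2 := Complex.norm_mul_sin_arg x
  simp only [circleMap_zero, Complex.mul_re, Complex.mul_im, Complex.conj_re, Complex.conj_im,
    Complex.exp_ofReal_mul_I_re, Complex.exp_ofReal_mul_I_im, Complex.ofReal_re, Complex.ofReal_im]
  rw [← h1, ← h2]
  ring

open scoped FourierTransform SchwartzMap LineDeriv

theorem angularCoeff_fourier (F : 𝓢(ℂ, ℂ)) (n : ℤ) (r : ℝ) :
    angularCoeff (𝓕 F : 𝓢(ℂ, ℂ)) n r = (-I) ^ n * ∫ x : ℂ, F x *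
      besselJ n (2 * π * r * ‖x‖) * ((starRingEnd ℂ) x / ‖x‖) ^ n := by
  have hpi : (π : ℂ) ≠ 0 := by exact_mod_cast pi_ne_zero
  rw [angularCoeff_eq_integral]
  simp_rw [SchwartzMap.fourier_coe, Real.fourier_eq', smul_eq_mul, ← integral_const_mul]
  have hint : Integrable (Function.uncurry fun (t : ℝ) (x : ℂ) => cexp (-(n * t * I)) *
      (cexp (((-2 * π * inner ℝ x (circleMap 0 r t) : ℝ) : ℂ) * I) * F x))
      ((volume.restrict (Set.Ioc (-π) π)).prod volume) := by
    have h1 : Integrable (fun p : ℝ × ℂ => (1 : ℂ) * F p.2)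
        ((volume.restrict (Set.Ioc (-π) π)).prod volume) :=
      Integrable.mul_prod (integrable_const (1 : ℂ)) F.integrable
    refine h1.mono ?_ (Filter.Eventually.of_forall fun p => ?_)
    · refine Continuous.aestronglyMeasurable ?_
      have := F.continuous
      unfold Function.uncurry circleMap
      fun_prop
    · have e1 : ‖cexp (-(n * p.1 * I))‖ = 1 := by
        rw [show -((n : ℂ) * p.1 * I) = ((-(n * p.1) : ℝ) : ℂ) * I by push_cast; ring]
        exact Complex.norm_exp_ofReal_mul_I _
      rw [Function.uncurry, norm_mul, norm_mul, e1, Complex.norm_exp_ofReal_mul_I]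
      simp
  rw [intervalIntegral.integral_of_le (neg_le_self pi_pos.le), integral_integral_swap hint,
    ← integral_const_mul]
  simp_rw [← intervalIntegral.integral_of_le (neg_le_self pi_pos.le)]
  refine integral_congr_ae ?_
  filter_upwards [compl_mem_ae_iff.2 (measure_singleton (0 : ℂ))] with x hx
  have hx : x ≠ 0 := hx
  simp_rw [inner_circleMap]
  have := integral_bessel_kernel n (2 * π * r) hx
  have e : ∀ t : ℝ, cexp (-(n * t * I)) *
      (cexp (((-2 * π * (r * (‖x‖ * Real.cos (t - arg x))) : ℝ) : ℂ) * I) * F x) =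
      F x * (cexp (-(n * t * I)) *
        cexp (-((2 * π * r * (‖x‖ * Real.cos (t - arg x)) : ℝ) : ℂ) * I)) := by
    intro t
    rw [show (-2 * π * (r * (‖x‖ * Real.cos (t - arg x)))) =
      -(2 * π * r * (‖x‖ * Real.cos (t - arg x))) by ring]
    push_cast
    ring
  simp_rw [e]
  rw [intervalIntegral.integral_const_mul, this]
  field_simp

theorem hasTemperateGrowth_inner_left (m : ℂ) :
    (fun z : ℂ => inner ℝ z m).HasTemperateGrowth :=
  ((innerSL ℝ).flip m).hasTemperateGrowth

open SchwartzMap in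
theorem fourier_smulLeftCLM_lineDerivOp (F : 𝓢(ℂ, ℂ)) {m m' : ℂ} (hm : inner ℝ m m' = 0) :
    𝓕 (smulLeftCLM ℂ (fun z : ℂ => inner ℝ z m) (∂_{m'} F)) =
      -smulLeftCLM ℂ (fun z : ℂ => inner ℝ z m') (∂_{m} (𝓕 F)) := by
  have hc : (2 * π * I : ℂ) ≠ 0 := Complex.two_pi_I_ne_zero
  have h1 := lineDerivOp_fourier_eq (∂_{m'} F) m
  rw [fourier_lineDerivOp_eq, FourierTransform.fourier_smul] at h1
  ext z
  have h2 := congrArg (fun g : 𝓢(ℂ, ℂ) => g z) h1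
  have hp : ∂_{m} ((2 * π * I : ℂ) • smulLeftCLM ℂ (fun z : ℂ => inner ℝ z m') (𝓕 F)) z =
      (2 * π * I : ℂ) * (inner ℝ z m' * ∂_{m} (𝓕 F) z) := by
    rw [lineDerivOp_apply_eq_fderiv, lineDerivOp_apply_eq_fderiv]
    have hd : HasFDerivAt (fun z => inner ℝ z m' • (𝓕 F) z) _ z :=
      HasFDerivAt.smul ((innerSL ℝ).flip m').hasFDerivAt ((𝓕 F).differentiableAt.hasFDerivAt)
    have hfun : ⇑((2 * π * I : ℂ) • smulLeftCLM ℂ (fun z : ℂ => inner ℝ z m') (𝓕 F)) =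
        (2 * π * I : ℂ) • fun z => inner ℝ z m' • (𝓕 F) z := by
      ext z
      rw [smul_apply, smulLeftCLM_apply_apply (hasTemperateGrowth_inner_left _),
        Pi.smul_apply]
    rw [hfun, (hd.const_smul (2 * π * I : ℂ)).fderiv]
    have hm' : (m.re * m'.re + m.im * m'.im : ℂ) = 0 := by
      rw [Complex.inner, Complex.mul_re, Complex.conj_re, Complex.conj_im] at hm
      exact_mod_cast (by linarith : m.re * m'.re + m.im * m'.im = 0)
    simp [innerSL_apply_apply ℝ]
    linear_combination 2 * π * I * (𝓕 F) z * hm'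
  simp only [hp, smul_apply] at h2
  rw [neg_apply, smulLeftCLM_apply_apply (hasTemperateGrowth_inner_left _)]
  refine mul_left_cancel₀ hc ?_
  simp only [smul_eq_mul, Complex.real_smul] at h2 ⊢
  linear_combination h2

/-- The orbital angular momentum operator on Schwartz functions of a complex variable. -/
def lzSchwartz (F : 𝓢(ℂ, ℂ)) : 𝓢(ℂ, ℂ) :=
  (-I) • (SchwartzMap.smulLeftCLM ℂ (fun z : ℂ => inner ℝ z (1 : ℂ)) (∂_{I} F) -
    SchwartzMap.smulLeftCLM ℂ (fun z : ℂ => inner ℝ z I) (∂_{(1 : ℂ)} F))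

theorem coe_lzSchwartz (F : 𝓢(ℂ, ℂ)) : ⇑(lzSchwartz F) = lzComplex F := by
  ext z
  rw [lzSchwartz, lzComplex, smul_apply, sub_apply,
    SchwartzMap.smulLeftCLM_apply_apply (hasTemperateGrowth_inner_left _),
    SchwartzMap.smulLeftCLM_apply_apply (hasTemperateGrowth_inner_left _),
    SchwartzMap.lineDerivOp_apply_eq_fderiv, SchwartzMap.lineDerivOp_apply_eq_fderiv]
  simp [Complex.inner]

theorem fourier_lzSchwartz (F : 𝓢(ℂ, ℂ)) : 𝓕 (lzSchwartz F) = lzSchwartz (𝓕 F) := by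
  rw [lzSchwartz, lzSchwartz, FourierTransform.fourier_smul, sub_eq_add_neg,
    FourierTransform.fourier_add, FourierTransform.fourier_neg,
    fourier_smulLeftCLM_lineDerivOp F (by simp [Complex.inner]),
    fourier_smulLeftCLM_lineDerivOp F (by simp [Complex.inner])]
  congr 1
  abel

theorem integrable_conj_mul (F G : 𝓢(ℂ, ℂ)) : Integrable fun z => (starRingEnd ℂ) (F z) * G z :=
  (F.memLp 2).star.integrable_mul (G.memLp 2)

theorem hasSum_integral_conj_mul_lzComplex (F : 𝓢(ℂ, ℂ)) :
    HasSum (fun n : ℤ => (n : ℂ) *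
        ((∫ r in Set.Ioi (0 : ℝ), ‖angularCoeff (𝓕 F : 𝓢(ℂ, ℂ)) n r‖ ^ 2 * r : ℝ) : ℂ))
      ((1 / (2 * π) : ℂ) * ∫ z, (starRingEnd ℂ) (F z) * lzComplex F z) := by
  have h := hasSum_integral_conj_angularCoeff_mul (𝓕 F).continuous (𝓕 (lzSchwartz F)).continuous
    (integrable_conj_mul _ _) (integrable_conj_mul _ _) (integrable_conj_mul _ _)
  have hpl := SchwartzMap.integral_inner_fourier_fourier F (lzSchwartz F)
  simp only [RCLike.inner_apply'] at hpl
  rw [hpl] at h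
  rw [← coe_lzSchwartz]
  convert! h using 1
  ext n
  rw [← integral_complex_ofReal, ← integral_const_mul]
  refine integral_congr_ae (Filter.Eventually.of_forall fun r => ?_)
  simp only
  rw [fourier_lzSchwartz, coe_lzSchwartz, angularCoeff_lzComplex ((𝓕 F).smooth 1)]
  push_cast
  rw [← Complex.conj_mul']
  ring

/-- The mean value of the orbital angular momentum is computed from the Bessel-wave
coefficients: `∫ conj f · (l_z f) = (1/(2π)) ∑_{n ∈ ℤ} n ∫₀^∞ |b_n(k)|² k dk`. -/
theorem mean_orbital_angular_momentum_from_bessel_coeffs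
    (f : SchwartzMap (ℝ × ℝ) ℂ) (b : ℤ → ℝ → ℂ)
    (hb : ∀ (n : ℤ) (k : ℝ), 0 < k → b n k =
      ∫ x : ℝ × ℝ, f x * besselJ n (k * Real.sqrt (x.1 ^ 2 + x.2 ^ 2)) *
        (((x.1 : ℂ) - Complex.I * (x.2 : ℂ)) /
          ((Real.sqrt (x.1 ^ 2 + x.2 ^ 2) : ℝ) : ℂ)) ^ n) :
    (∫ x : ℝ × ℝ, (starRingEnd ℂ) (f x) * lz (fun y => f y) x)
      = (1 / (2 * Real.pi) : ℂ) *
          ∑' n : ℤ, (n : ℂ) * ((∫ k in Set.Ioi (0 : ℝ), ‖b n k‖ ^ 2 * k : ℝ) : ℂ) := by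
  set F : 𝓢(ℂ, ℂ) :=
    SchwartzMap.compCLMOfContinuousLinearEquiv ℂ Complex.equivRealProdCLM f
  have hFx : ∀ z : ℂ, F z = f (Complex.measurableEquivRealProd z) := fun z => rfl
  have htr : ∀ g : ℝ × ℝ → ℂ, ∫ x, g x = ∫ z : ℂ, g (Complex.measurableEquivRealProd z) :=
    fun g => (Complex.volume_preserving_equiv_real_prod.integral_comp
      Complex.measurableEquivRealProd.measurableEmbedding g).symm
  have hlz : ∀ z : ℂ, lz (fun y => f y) (Complex.measurableEquivRealProd z) = lzComplex F z := by
    intro z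
    have hd : fderiv ℝ F z = (fderiv ℝ f (Complex.measurableEquivRealProd z)).comp
        (Complex.equivRealProdCLM : ℂ →L[ℝ] ℝ × ℝ) :=
      ((f.differentiableAt.hasFDerivAt).comp z
        (Complex.equivRealProdCLM : ℂ →L[ℝ] ℝ × ℝ).hasFDerivAt).fderiv
    rw [lz, lzComplex, hd]
    simp [Complex.measurableEquivRealProd]
  have hbn : ∀ (n : ℤ) (k : ℝ), 0 < k →
      ‖b n k‖ = ‖angularCoeff (𝓕 F : 𝓢(ℂ, ℂ)) n ((2 * π)⁻¹ * k)‖ := by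
    intro n k hk
    rw [hb n k hk, angularCoeff_fourier, norm_mul, norm_zpow, norm_neg, norm_I, one_zpow, one_mul,
      htr]
    congr 2
    ext z
    have e1 : 2 * π * ((2 * π)⁻¹ * k) = k := by
      field_simp
    have e2 : √(z.re ^ 2 + z.im ^ 2) = ‖z‖ := by
      rw [Complex.norm_def, Complex.normSq_apply, sq, sq]
    have e3 : (z.re : ℂ) - I * z.im = (starRingEnd ℂ) z := by
      apply Complex.ext <;> simp
    rw [e1, hFx]
    simp only [Complex.measurableEquivRealProd_apply, e2, e3]
  have hscale : ∀ n : ℤ, ∫ k in Set.Ioi (0 : ℝ), ‖b n k‖ ^ 2 * k = (2 * π) ^ 2 *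
      ∫ r in Set.Ioi (0 : ℝ), ‖angularCoeff (𝓕 F : 𝓢(ℂ, ℂ)) n r‖ ^ 2 * r := by
    intro n
    have := integral_comp_mul_left_Ioi
      (fun r => ‖angularCoeff (𝓕 F : 𝓢(ℂ, ℂ)) n r‖ ^ 2 * r) 0 (b := (2 * π)⁻¹) (by positivity)
    rw [mul_zero, inv_inv, smul_eq_mul] at this
    rw [sq (2 * π), mul_assoc, ← this, ← integral_const_mul]
    refine setIntegral_congr_fun measurableSet_Ioi fun k hk => ?_
    rw [hbn n k hk]
    field_simp
  have hsum := ((hasSum_integral_conj_mul_lzComplex F).mul_left ((2 * π : ℂ) ^ 2)).tsum_eq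
  rw [htr]
  simp_rw [hlz, ← hFx]
  have hpi : (π : ℂ) ≠ 0 := by exact_mod_cast pi_ne_zero
  have e : ∀ n : ℤ, (n : ℂ) * ((∫ k in Set.Ioi (0 : ℝ), ‖b n k‖ ^ 2 * k : ℝ) : ℂ) =
      (2 * π : ℂ) ^ 2 * ((n : ℂ) * ((∫ r in Set.Ioi (0 : ℝ),
        ‖angularCoeff (𝓕 F : 𝓢(ℂ, ℂ)) n r‖ ^ 2 * r : ℝ) : ℂ)) := by
    intro n
    rw [hscale]
    push_cast
    ring
  simp_rw [e]
  rw [hsum]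
  field_simp

end
end

section
/- The conserved operator of elliptic-cylindrical (Mathieu) waves commutes with the Laplacian: fix a > 0 (half the inter-foci distance) and define, on smooth functions f : ℝ² → ℂ, the operator W f = l_z(l_z f) + a² p_x(p_x f), where (p_x f)(x) = −i ∂f/∂x₁ (x). Then for every smooth f : ℝ² → ℂ, Δ(W f) = W(Δ f), where Δ is the Laplacian on ℝ². -/
open Complex

noncomputable section

/-- The linear momentum operator `p_x` on functions on ℝ²: `(p_x f)(x) = −i ∂f/∂x₁ (x)`. -/
def px (f : ℝ × ℝ → ℂ) (x : ℝ × ℝ) : ℂ :=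
  -Complex.I * fderiv ℝ f x ((1 : ℝ), (0 : ℝ))

/-- The Laplacian on ℝ² (sum of second partial derivatives). -/
def laplacian2 (f : ℝ × ℝ → ℂ) (x : ℝ × ℝ) : ℂ :=
  fderiv ℝ (fun y => fderiv ℝ f y ((1 : ℝ), (0 : ℝ))) x ((1 : ℝ), (0 : ℝ))
    + fderiv ℝ (fun y => fderiv ℝ f y ((0 : ℝ), (1 : ℝ))) x ((0 : ℝ), (1 : ℝ))

open scoped ContDiff in
/-- The derivative along a fixed vector of a smooth function is smooth. -/
theorem contDiff_fderiv_apply_const {f : ℝ × ℝ → ℂ} (hf : ContDiff ℝ ∞ f) (v : ℝ × ℝ) :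
    ContDiff ℝ ∞ (fun y => fderiv ℝ f y v) :=
  (hf.fderiv_right (m := ∞) (by simp)).clm_apply contDiff_const

open scoped ContDiff in
/-- Mixed directional derivatives of a smooth function commute. -/
theorem fderiv_fderiv_apply_comm {f : ℝ × ℝ → ℂ} (hf : ContDiff ℝ ∞ f) (v w : ℝ × ℝ) :
    (fun x => fderiv ℝ (fun y => fderiv ℝ f y v) x w) =
      fun x => fderiv ℝ (fun y => fderiv ℝ f y w) x v := by
  funext x
  have hd : DifferentiableAt ℝ (fderiv ℝ f) x :=
    (hf.fderiv_right (m := ∞) (by simp)).differentiable (by simp) x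
  have hsymm : IsSymmSndFDerivAt ℝ f x :=
    hf.contDiffAt.isSymmSndFDerivAt (by
      simpa using (WithTop.coe_le_coe.2 le_top : ((2 : ℕ∞) : WithTop ℕ∞) ≤ ∞))
  rw [fderiv_clm_apply hd (differentiableAt_const v),
    fderiv_clm_apply hd (differentiableAt_const w)]
  simpa using hsymm w v

theorem hasFDerivAt_ofReal_fst (x : ℝ × ℝ) : HasFDerivAt (fun y : ℝ × ℝ => (y.1 : ℂ))
    (Complex.ofRealCLM.comp (ContinuousLinearMap.fst ℝ ℝ ℝ)) x :=
  (Complex.ofRealCLM.comp (ContinuousLinearMap.fst ℝ ℝ ℝ)).hasFDerivAt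

theorem hasFDerivAt_ofReal_snd (x : ℝ × ℝ) : HasFDerivAt (fun y : ℝ × ℝ => (y.2 : ℂ))
    (Complex.ofRealCLM.comp (ContinuousLinearMap.snd ℝ ℝ ℝ)) x :=
  (Complex.ofRealCLM.comp (ContinuousLinearMap.snd ℝ ℝ ℝ)).hasFDerivAt

/-- The directional derivative of `α (x₁ g - x₂ h)`. -/
theorem fderiv_mul_fst_mul_sub_snd_mul {g h : ℝ × ℝ → ℂ} {x : ℝ × ℝ}
    (hg : DifferentiableAt ℝ g x) (hh : DifferentiableAt ℝ h x) (α : ℂ) (v : ℝ × ℝ) :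
    fderiv ℝ (fun y : ℝ × ℝ => α * ((y.1 : ℂ) * g y - (y.2 : ℂ) * h y)) x v =
      α * ((v.1 : ℂ) * g x - (v.2 : ℂ) * h x) +
        α * ((x.1 : ℂ) * fderiv ℝ g x v - (x.2 : ℂ) * fderiv ℝ h x v) := by
  rw [((((hasFDerivAt_ofReal_fst x).fun_mul hg.hasFDerivAt).fun_sub
    ((hasFDerivAt_ofReal_snd x).fun_mul hh.hasFDerivAt)).const_mul α).fderiv]
  simp
  ring

open scoped ContDiff in
theorem contDiff_lz {f : ℝ × ℝ → ℂ} (hf : ContDiff ℝ ∞ f) : ContDiff ℝ ∞ (lz f) := by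
  have h1 : ContDiff ℝ ∞ (fun y : ℝ × ℝ => (y.1 : ℂ)) :=
    Complex.ofRealCLM.contDiff.comp contDiff_fst
  have h2 : ContDiff ℝ ∞ (fun y : ℝ × ℝ => (y.2 : ℂ)) :=
    Complex.ofRealCLM.contDiff.comp contDiff_snd
  exact contDiff_const.mul ((h1.mul (contDiff_fderiv_apply_const hf _)).sub
    (h2.mul (contDiff_fderiv_apply_const hf _)))

open scoped ContDiff in
theorem contDiff_px {f : ℝ × ℝ → ℂ} (hf : ContDiff ℝ ∞ f) : ContDiff ℝ ∞ (px f) :=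
  contDiff_const.mul (contDiff_fderiv_apply_const hf _)

open scoped ContDiff in
/-- The Laplacian is linear on smooth functions. -/
theorem laplacian2_add_const_mul {f g : ℝ × ℝ → ℂ} (hf : ContDiff ℝ ∞ f) (hg : ContDiff ℝ ∞ g)
    (c : ℂ) (x : ℝ × ℝ) :
    laplacian2 (fun y => f y + c * g y) x = laplacian2 f x + c * laplacian2 g x := by
  have key {f g : ℝ × ℝ → ℂ} (hf : ContDiff ℝ ∞ f) (hg : ContDiff ℝ ∞ g) (v : ℝ × ℝ) :
      (fun y => fderiv ℝ (fun z => f z + c * g z) y v) =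
        fun y => fderiv ℝ f y v + c * fderiv ℝ g y v := by
    funext y
    rw [((hf.differentiable (by simp) y).hasFDerivAt.fun_add
      ((hg.differentiable (by simp) y).hasFDerivAt.const_mul c)).fderiv]
    simp
  have second (v : ℝ × ℝ) := congrFun (key (contDiff_fderiv_apply_const hf v)
    (contDiff_fderiv_apply_const hg v) v) x
  simp only [laplacian2, key hf hg, second]
  ring

open scoped ContDiff in
theorem laplacian2_px {f : ℝ × ℝ → ℂ} (hf : ContDiff ℝ ∞ f) :
    laplacian2 (px f) = px (laplacian2 f) := by
  funext x
  have hd := contDiff_fderiv_apply_const hf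
  have hlin := laplacian2_add_const_mul (f := fun _ => 0) contDiff_const (hd (1, 0)) (-Complex.I) x
  have hdd (v w : ℝ × ℝ) : DifferentiableAt ℝ (fun y => fderiv ℝ (fun z => fderiv ℝ f z v) y w) x :=
    (contDiff_fderiv_apply_const (hd v) w).differentiable (by simp) x
  have hpx : px f = fun y => 0 + -Complex.I * fderiv ℝ f y (1, 0) := by
    funext y
    simp [px]
  rw [hpx, hlin]
  unfold px laplacian2
  rw [fderiv_fun_add (hdd _ _) (hdd _ _), fderiv_fderiv_apply_comm hf (1, 0) (0, 1),
    congrFun (fderiv_fderiv_apply_comm (hd (0, 1)) (1, 0) (0, 1)) x]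
  simp

open scoped ContDiff in
theorem laplacian2_lz {f : ℝ × ℝ → ℂ} (hf : ContDiff ℝ ∞ f) :
    laplacian2 (lz f) = lz (laplacian2 f) := by
  funext x
  have hd := contDiff_fderiv_apply_const hf
  have hdd (v w : ℝ × ℝ) := contDiff_fderiv_apply_const (hd v) w
  have hfst (v : ℝ × ℝ) : (fun y => fderiv ℝ (lz f) y v) = fun y =>
      -Complex.I * ((v.1 : ℂ) * fderiv ℝ f y (0, 1) - (v.2 : ℂ) * fderiv ℝ f y (1, 0)) +
        -Complex.I * ((y.1 : ℂ) * fderiv ℝ (fun z => fderiv ℝ f z (0, 1)) y v -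
          (y.2 : ℂ) * fderiv ℝ (fun z => fderiv ℝ f z (1, 0)) y v) := by
    funext y
    exact fderiv_mul_fst_mul_sub_snd_mul ((hd _).differentiable (by simp) y)
      ((hd _).differentiable (by simp) y) _ _
  have hsnd (v : ℝ × ℝ) : fderiv ℝ (fun y => fderiv ℝ (lz f) y v) x v =
      -2 * Complex.I * ((v.1 : ℂ) * fderiv ℝ (fun z => fderiv ℝ f z (0, 1)) x v -
          (v.2 : ℂ) * fderiv ℝ (fun z => fderiv ℝ f z (1, 0)) x v) +
        -Complex.I *
          ((x.1 : ℂ) * fderiv ℝ (fun y => fderiv ℝ (fun z => fderiv ℝ f z (0, 1)) y v) x v -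
          (x.2 : ℂ) * fderiv ℝ (fun y => fderiv ℝ (fun z => fderiv ℝ f z (1, 0)) y v) x v) := by
    have hA (w : ℝ × ℝ) := (hd w).differentiable (by simp) x
    have hB (w : ℝ × ℝ) := (hdd w v).differentiable (by simp) x
    rw [hfst, (((((hA (0, 1)).hasFDerivAt.const_mul (v.1 : ℂ)).fun_sub
      ((hA (1, 0)).hasFDerivAt.const_mul (v.2 : ℂ))).const_mul (-Complex.I)).fun_add
      ((((hasFDerivAt_ofReal_fst x).fun_mul (hB (0, 1)).hasFDerivAt).fun_sub
        ((hasFDerivAt_ofReal_snd x).fun_mul (hB (1, 0)).hasFDerivAt)).const_mul (-Complex.I))).fderiv]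
    simp
    ring
  have hlap (w : ℝ × ℝ) : fderiv ℝ (laplacian2 f) x w =
      fderiv ℝ (fun y => fderiv ℝ (fun z => fderiv ℝ f z w) y (1, 0)) x (1, 0) +
        fderiv ℝ (fun y => fderiv ℝ (fun z => fderiv ℝ f z w) y (0, 1)) x (0, 1) := by
    unfold laplacian2
    rw [fderiv_fun_add ((hdd _ _).differentiable (by simp) x)
      ((hdd _ _).differentiable (by simp) x), fderiv_fderiv_apply_comm hf w (1, 0),
      fderiv_fderiv_apply_comm hf w (0, 1),
      congrFun (fderiv_fderiv_apply_comm (hd (1, 0)) w (1, 0)) x,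
      congrFun (fderiv_fderiv_apply_comm (hd (0, 1)) w (0, 1)) x]
    rfl
  have hsymm := congrFun (fderiv_fderiv_apply_comm hf (0, 1) (1, 0)) x
  rw [laplacian2, hsnd, hsnd, lz, hlap, hlap, hsymm]
  simp
  ring

/-- The conserved operator of elliptic-cylindrical (Mathieu) waves,
`W f = l_z² f + a² p_x² f`, commutes with the Laplacian on smooth functions. -/
theorem mathieu_operator_commutes_with_laplacian (a : ℝ) (ha : 0 < a)
    (W : (ℝ × ℝ → ℂ) → (ℝ × ℝ → ℂ))
    (hW : ∀ (f : ℝ × ℝ → ℂ) (x : ℝ × ℝ),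
      W f x = lz (lz f) x + (a : ℂ) ^ 2 * px (px f) x)
    (f : ℝ × ℝ → ℂ) (hf : ContDiff ℝ (⊤ : ℕ∞) f) (x : ℝ × ℝ) :
    laplacian2 (W f) x = W (laplacian2 f) x := by
  have hW' (g : ℝ × ℝ → ℂ) : W g = fun y => lz (lz g) y + (a : ℂ) ^ 2 * px (px g) y :=
    funext (hW g)
  rw [hW', laplacian2_add_const_mul (contDiff_lz (contDiff_lz hf)) (contDiff_px (contDiff_px hf)),
    laplacian2_lz (contDiff_lz hf), laplacian2_lz hf, laplacian2_px (contDiff_px hf),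
    laplacian2_px hf, hW]

end
end

section
/- The Bessel functions defined by the integral representation satisfy Bessel's differential equation (the radial part of the Helmholtz equation in circular-cylindrical coordinates): for every n ∈ ℤ, J_n is smooth on ℝ and for all x ≠ 0, J_n''(x) + (1/x) J_n'(x) + (1 − n²/x²) J_n(x) = 0. -/
open Real Complex

noncomputable section

/-- The Bessel kernel `exp(i (x sin τ − n τ))`. -/
def besselKernel (n : ℤ) (x τ : ℝ) : ℂ :=
  Complex.exp (Complex.I * ((x : ℂ) * Real.sin τ - (n : ℂ) * (τ : ℂ)))

/-- The Bessel kernel integrated over a period against an amplitude `a`. -/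
def besselIntegral (n : ℤ) (a : ℝ → ℂ) (x : ℝ) : ℂ :=
  ∫ τ in (-Real.pi)..Real.pi, a τ * besselKernel n x τ

lemma continuous_besselKernel (n : ℤ) (x : ℝ) : Continuous (besselKernel n x) := by
  unfold besselKernel
  fun_prop

lemma norm_besselKernel (n : ℤ) (x τ : ℝ) : ‖besselKernel n x τ‖ = 1 := by
  have h : Complex.I * ((x : ℂ) * Real.sin τ - (n : ℂ) * (τ : ℂ)) =
      ((x * Real.sin τ - n * τ : ℝ) : ℂ) * Complex.I := by
    push_cast
    ring
  rw [besselKernel, h, Complex.norm_exp_ofReal_mul_I]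

lemma hasDerivAt_besselKernel_left (n : ℤ) (x τ : ℝ) :
    HasDerivAt (fun y => besselKernel n y τ)
      (Complex.I * Real.sin τ * besselKernel n x τ) x := by
  have h := (((((hasDerivAt_id x).ofReal_comp).mul_const (Real.sin τ : ℂ)).sub_const
    ((n : ℂ) * (τ : ℂ))).const_mul Complex.I).cexp
  refine h.congr_deriv ?_
  simp only [besselKernel, id_eq]
  push_cast
  ring

lemma hasDerivAt_besselKernel_right (n : ℤ) (x τ : ℝ) :
    HasDerivAt (besselKernel n x)
      (Complex.I * (x * Real.cos τ - n) * besselKernel n x τ) τ := by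
  have h := (((((Real.hasDerivAt_sin τ).ofReal_comp).const_mul (x : ℂ)).sub
    (((hasDerivAt_id τ).ofReal_comp).const_mul (n : ℂ))).const_mul Complex.I).cexp
  refine h.congr_deriv ?_
  simp only [besselKernel, id_eq, Pi.sub_apply]
  push_cast
  ring

lemma besselKernel_neg_pi (n : ℤ) (x : ℝ) :
    besselKernel n x (-Real.pi) = besselKernel n x Real.pi := by
  rw [besselKernel, besselKernel, Complex.exp_eq_exp_iff_exists_int]
  refine ⟨n, ?_⟩
  simp only [Real.sin_neg, Real.sin_pi]
  push_cast
  ring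

lemma hasDerivAt_besselIntegral (n : ℤ) {a : ℝ → ℂ} (ha : Continuous a) (x : ℝ) :
    HasDerivAt (besselIntegral n a)
      (besselIntegral n (fun τ => a τ * (Complex.I * Real.sin τ)) x) x := by
  have hsin : Continuous fun τ : ℝ => a τ * (Complex.I * Real.sin τ) := by fun_prop
  refine (intervalIntegral.hasDerivAt_integral_of_dominated_loc_of_deriv_le
    (F := fun y τ => a τ * besselKernel n y τ)
    (F' := fun y τ => a τ * (Complex.I * Real.sin τ) * besselKernel n y τ)
    (bound := fun τ => ‖a τ * (Complex.I * Real.sin τ)‖) Filter.univ_mem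
    (.of_forall fun y => (ha.mul (continuous_besselKernel n y)).aestronglyMeasurable)
    ((ha.mul (continuous_besselKernel n x)).intervalIntegrable _ _)
    (hsin.mul (continuous_besselKernel n x)).aestronglyMeasurable
    (.of_forall fun τ _ y _ => ?_) (hsin.norm.intervalIntegrable _ _)
    (.of_forall fun τ _ y _ => ?_)).2
  · rw [norm_mul _ (besselKernel n y τ), norm_besselKernel, mul_one]
  · exact ((hasDerivAt_besselKernel_left n y τ).const_mul (a τ)).congr_deriv (mul_assoc _ _ _).symm

lemma contDiff_besselIntegral (n : ℤ) {a : ℝ → ℂ} (ha : Continuous a) :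
    ContDiff ℝ (⊤ : ℕ∞) (besselIntegral n a) := by
  rw [contDiff_infty]
  intro m
  induction m generalizing a with
  | zero =>
    rw [Nat.cast_zero, contDiff_zero, continuous_iff_continuousAt]
    exact fun x => (hasDerivAt_besselIntegral n ha x).continuousAt
  | succ m ih =>
    rw [Nat.cast_succ, contDiff_succ_iff_deriv]
    refine ⟨fun x => (hasDerivAt_besselIntegral n ha x).differentiableAt, by simp, ?_⟩
    rw [funext fun x => (hasDerivAt_besselIntegral n ha x).deriv]
    exact ih (by fun_prop)

lemma besselJ_eq_besselIntegral (n : ℤ) :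
    besselJ n = fun x => 1 / (2 * Real.pi) * besselIntegral n (fun _ => 1) x := by
  funext x
  simp only [besselJ, besselIntegral, besselKernel, one_mul]

lemma hasDerivAt_besselPrimitive (n : ℤ) (x τ : ℝ) :
    HasDerivAt (fun t : ℝ => -Complex.I * (x * Real.cos t + n) * besselKernel n x t)
      ((x ^ 2 * Real.cos τ ^ 2 + Complex.I * x * Real.sin τ - n ^ 2) * besselKernel n x τ) τ := by
  have h := (((((Real.hasDerivAt_cos τ).ofReal_comp).const_mul (x : ℂ)).add_const
    (n : ℂ)).const_mul (-Complex.I)).mul (hasDerivAt_besselKernel_right n x τ)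
  refine h.congr_deriv ?_
  push_cast
  linear_combination
    -(x ^ 2 * Complex.cos τ ^ 2 - n ^ 2) * besselKernel n x τ * Complex.I_sq

lemma besselIntegral_ode (n : ℤ) (x : ℝ) :
    x ^ 2 * besselIntegral n (fun τ => Complex.I * Real.sin τ * (Complex.I * Real.sin τ)) x +
      x * besselIntegral n (fun τ => Complex.I * Real.sin τ) x +
      (x ^ 2 - n ^ 2) * besselIntegral n (fun _ => 1) x = 0 := by
  have hk := continuous_besselKernel n x
  have hint : ∫ τ in (-Real.pi)..Real.pi,
      (x ^ 2 * Real.cos τ ^ 2 + Complex.I * x * Real.sin τ - n ^ 2) * besselKernel n x τ = 0 := by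
    rw [intervalIntegral.integral_eq_sub_of_hasDerivAt
      (fun τ _ => hasDerivAt_besselPrimitive n x τ)
      (Continuous.intervalIntegrable (by fun_prop) _ _), besselKernel_neg_pi, Real.cos_neg,
      sub_self]
  simp only [besselIntegral]
  rw [← intervalIntegral.integral_const_mul, ← intervalIntegral.integral_const_mul,
    ← intervalIntegral.integral_const_mul,
    ← intervalIntegral.integral_add (Continuous.intervalIntegrable (by fun_prop) _ _)
      (Continuous.intervalIntegrable (by fun_prop) _ _),
    ← intervalIntegral.integral_add (Continuous.intervalIntegrable (by fun_prop) _ _)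
      (Continuous.intervalIntegrable (by fun_prop) _ _), ← hint]
  refine intervalIntegral.integral_congr fun τ _ => ?_
  push_cast
  linear_combination
    x ^ 2 * Complex.sin τ ^ 2 * besselKernel n x τ * Complex.I_sq -
      x ^ 2 * besselKernel n x τ * Complex.sin_sq_add_cos_sq τ

/-- The Bessel functions are smooth and satisfy Bessel's differential equation
`J_n'' + (1/x) J_n' + (1 − n²/x²) J_n = 0` for `x ≠ 0`. -/
theorem besselJ_satisfies_bessel_ode (n : ℤ) :
    ContDiff ℝ (⊤ : ℕ∞) (besselJ n) ∧
    ∀ x : ℝ, x ≠ 0 →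
      deriv (deriv (besselJ n)) x + ((1 / x : ℝ) : ℂ) * deriv (besselJ n) x +
        (1 - ((n : ℂ) ^ 2) / ((x : ℂ) ^ 2)) * besselJ n x = 0 := by
  have h1 : deriv (besselJ n) = fun x =>
      1 / (2 * Real.pi) * besselIntegral n (fun τ => Complex.I * Real.sin τ) x := by
    funext x
    rw [besselJ_eq_besselIntegral]
    simpa only [one_mul] using
      ((hasDerivAt_besselIntegral n (a := fun _ => 1) continuous_const x).const_mul
        (1 / (2 * Real.pi) : ℂ)).deriv
  refine ⟨?_, fun x hx => ?_⟩
  · rw [besselJ_eq_besselIntegral]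
    exact contDiff_const.mul (contDiff_besselIntegral n continuous_const)
  · have h2 := ((hasDerivAt_besselIntegral n (a := fun τ => Complex.I * Real.sin τ)
      (by fun_prop) x).const_mul (1 / (2 * Real.pi) : ℂ)).deriv
    have hx' : (x : ℂ) ≠ 0 := Complex.ofReal_ne_zero.mpr hx
    rw [h1, h2, besselJ_eq_besselIntegral]
    have hode := besselIntegral_ode n x
    rw [Complex.ofReal_div, Complex.ofReal_one]
    beta_reduce
    generalize besselIntegral n (fun τ => Complex.I * Real.sin τ * (Complex.I * Real.sin τ)) x = A,
      besselIntegral n (fun τ => Complex.I * Real.sin τ) x = B,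
      besselIntegral n (fun _ => 1) x = C at hode ⊢
    field_simp
    linear_combination hode

end
end
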